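/- arXiv:0712.2891 — 2 statements merged into one kernel-verified Lean document; each statement's English description precedes it below -/
import Mathlib

section
/- For m = 3, the homotopy relation on transversal Volterra operators has exactly 8 equivalence classes: there exist 8 transversal real skew-symmetric 3×3 matrices with entries of absolute value ≤ 1 whose associated Volterra operators are pairwise non-homotopic, such that every transversal real skew-symmetric 3×3 matrix with entries of absolute value ≤ 1 has its Volterra operator homotopic to one of these 8. -/
open Matrix

/-- A matrix defining a Volterra quadratic stochastic operator:
skew-symmetric with entries of absolute value at most 1. -/
def IsQSOMatrix {n : Type*} [Fintype n] (A : Matrix n n ℝ) : Prop :=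
  Aᵀ = -A ∧ ∀ i j, |A i j| ≤ 1

/-- The Volterra quadratic stochastic operator associated to a matrix `A`:
`(V_A x)_k = x_k (1 + ∑ i, a_{k i} x_i)`. -/
noncomputable def volterra {n : Type*} [Fintype n] (A : Matrix n n ℝ) (x : n → ℝ) : n → ℝ :=
  fun k => x k * (1 + ∑ i, A k i * x i)

/-- The set of fixed points of `V_A` in the standard simplex. -/
def FixSet {n : Type*} [Fintype n] (A : Matrix n n ℝ) : Set (n → ℝ) :=
  {x ∈ stdSimplex ℝ n | volterra A x = x}

/-- A skew-symmetric matrix is transversal if every principal submatrix on an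
evenly-sized index set has nonzero determinant. -/
def IsTransversal {n : Type*} [Fintype n] [DecidableEq n] (A : Matrix n n ℝ) : Prop :=
  ∀ s : Finset n, Even s.card →
    (A.submatrix (fun i : s => (i : n)) (fun i : s => (i : n))).det ≠ 0

/-- Two (transversal) Volterra operators are homotopic if they are joined by a
continuous family of transversal Volterra matrices along which the number of
fixed points is constant. -/
def QSOHomotopic {n : Type*} [Fintype n] [DecidableEq n] (A₀ A₁ : Matrix n n ℝ) : Prop :=
  ∃ A : ℝ → Matrix n n ℝ,
    ContinuousOn A (Set.Icc 0 1) ∧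
    A 0 = A₀ ∧ A 1 = A₁ ∧
    (∀ t ∈ Set.Icc (0:ℝ) 1, IsQSOMatrix (A t) ∧ IsTransversal (A t)) ∧
    (∀ t ∈ Set.Icc (0:ℝ) 1, (FixSet (A t)).ncard = (FixSet A₀).ncard) ∧
    (FixSet A₀).ncard = (FixSet A₁).ncard

/-- The skew-symmetric `3 × 3` matrix whose kernel is spanned by `(b, c, a)`. -/
def skewThree (a b c : ℝ) : Matrix (Fin 3) (Fin 3) ℝ :=
  !![0, a, -c; -a, 0, b; c, -b, 0]

theorem skewThree_isQSOMatrix {a b c : ℝ} (ha : |a| ≤ 1) (hb : |b| ≤ 1) (hc : |c| ≤ 1) :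
    IsQSOMatrix (skewThree a b c) := by
  constructor
  · ext i j
    fin_cases i <;> fin_cases j <;> simp [skewThree]
  · intro i j
    fin_cases i <;> fin_cases j <;> simp [skewThree, ha, hb, hc]

theorem IsQSOMatrix.apply_swap {n : Type*} [Fintype n] {A : Matrix n n ℝ} (hA : IsQSOMatrix A)
    (i j : n) : A j i = -A i j :=
  congrFun (congrFun hA.1 i) j

theorem IsQSOMatrix.apply_self {n : Type*} [Fintype n] {A : Matrix n n ℝ} (hA : IsQSOMatrix A)
    (i : n) : A i i = 0 := by
  linarith [hA.apply_swap i i]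

theorem IsQSOMatrix.eq_skewThree {A : Matrix (Fin 3) (Fin 3) ℝ} (hA : IsQSOMatrix A) :
    A = skewThree (A 0 1) (A 1 2) (A 2 0) := by
  ext i j
  fin_cases i <;> fin_cases j <;>
    simp [skewThree, hA.apply_self, hA.apply_swap 0 1, hA.apply_swap 1 2, hA.apply_swap 2 0]

theorem IsTransversal.apply_ne_zero {n : Type*} [Fintype n] [DecidableEq n] {A : Matrix n n ℝ}
    (hT : IsTransversal A) (hA : IsQSOMatrix A) {i j : n} (hij : i ≠ j) : A i j ≠ 0 := by
  intro h
  have h' : A j i = 0 := by rw [hA.apply_swap, h, neg_zero]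
  refine hT {i, j} (by simp [Finset.card_pair hij]) ?_
  have hzero : A.submatrix (fun k : ({i, j} : Finset n) => (k : n))
      (fun k : ({i, j} : Finset n) => (k : n)) = 0 := by
    ext ⟨k, hk⟩ ⟨l, hl⟩
    simp only [Finset.mem_insert, Finset.mem_singleton] at hk hl
    rcases hk with rfl | rfl <;> rcases hl with rfl | rfl <;> simp [h, h', hA.apply_self]
  rw [hzero]
  have : Nonempty ({i, j} : Finset n) := ⟨⟨i, by simp⟩⟩
  exact Matrix.det_zero

theorem IsQSOMatrix.isTransversal_of_apply_ne_zero {A : Matrix (Fin 3) (Fin 3) ℝ}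
    (hA : IsQSOMatrix A) (h : ∀ i j, i ≠ j → A i j ≠ 0) : IsTransversal A := by
  intro s hs
  have hcard : s.card = 0 ∨ s.card = 2 := by
    have h3 : s.card ≤ 3 := by simpa using s.card_le_univ
    obtain ⟨k, hk⟩ := hs
    omega
  rcases hcard with h0 | h2
  · rw [Finset.card_eq_zero] at h0
    subst h0
    simp
  · let e : Fin 2 ≃ s := (s.equivFinOfCardEq h2).symm
    rw [← Matrix.det_submatrix_equiv_self e, Matrix.det_fin_two]
    have hne : (e 0 : Fin 3) ≠ e 1 := fun heq => by
      simpa using e.injective (Subtype.ext heq)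
    simp [hA.apply_self, h _ _ hne, h _ _ hne.symm]

theorem skewThree_isTransversal {a b c : ℝ} (ha : |a| ≤ 1) (hb : |b| ≤ 1) (hc : |c| ≤ 1)
    (ha0 : a ≠ 0) (hb0 : b ≠ 0) (hc0 : c ≠ 0) : IsTransversal (skewThree a b c) := by
  refine (skewThree_isQSOMatrix ha hb hc).isTransversal_of_apply_ne_zero fun i j hij => ?_
  fin_cases i <;> fin_cases j <;> simp_all [skewThree]

theorem mem_fixSet_skewThree {a b c : ℝ} {x : Fin 3 → ℝ} :
    x ∈ FixSet (skewThree a b c) ↔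
      (0 ≤ x 0 ∧ 0 ≤ x 1 ∧ 0 ≤ x 2 ∧ x 0 + x 1 + x 2 = 1) ∧
      x 0 * (a * x 1 - c * x 2) = 0 ∧ x 1 * (b * x 2 - a * x 0) = 0 ∧
      x 2 * (c * x 0 - b * x 1) = 0 := by
  simp only [FixSet, stdSimplex, volterra, skewThree, Set.mem_ofPred_eq, funext_iff,
    Fin.forall_fin_succ, Fin.sum_univ_three]
  simp
  grind

theorem vertices_subset_fixSet_skewThree (a b c : ℝ) :
    {![1, 0, 0], ![0, 1, 0], ![0, 0, 1]} ⊆ FixSet (skewThree a b c) := by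
  rintro x (rfl | rfl | rfl) <;> simp [mem_fixSet_skewThree]

theorem eq_vertex_or_pos_of_mem_fixSet_skewThree {a b c : ℝ} {x : Fin 3 → ℝ} (ha : a ≠ 0)
    (hb : b ≠ 0) (hc : c ≠ 0) (hx : x ∈ FixSet (skewThree a b c)) :
    (x = ![1, 0, 0] ∨ x = ![0, 1, 0] ∨ x = ![0, 0, 1]) ∨
      (0 < x 0 ∧ 0 < x 1 ∧ 0 < x 2) ∧ a * x 1 = c * x 2 ∧ b * x 2 = a * x 0 ∧
        c * x 0 = b * x 1 := by
  obtain ⟨⟨h0, h1, h2, hsum⟩, e0, e1, e2⟩ := mem_fixSet_skewThree.1 hx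
  have hvec (u v w : ℝ) : x = ![u, v, w] ↔ x 0 = u ∧ x 1 = v ∧ x 2 = w := by
    simp [funext_iff, Fin.forall_fin_succ]
  simp only [hvec]
  simp only [mul_eq_zero, sub_eq_zero] at e0 e1 e2
  rcases h0.eq_or_lt with z0 | p0 <;> rcases h1.eq_or_lt with z1 | p1 <;>
    rcases h2.eq_or_lt with z2 | p2 <;> grind

theorem fixSet_skewThree_of_same_sign {a b c : ℝ} (hab : 0 < a * b) (hbc : 0 < b * c) :
    FixSet (skewThree a b c) = {![1, 0, 0], ![0, 1, 0], ![0, 0, 1],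
      ![b / (a + b + c), c / (a + b + c), a / (a + b + c)]} := by
  have ha : a ≠ 0 := left_ne_zero_of_mul hab.ne'
  have hb : b ≠ 0 := left_ne_zero_of_mul hbc.ne'
  have hc : c ≠ 0 := right_ne_zero_of_mul hbc.ne'
  have hsign : (0 < a ∧ 0 < b ∧ 0 < c) ∨ (a < 0 ∧ b < 0 ∧ c < 0) := by
    rcases mul_pos_iff.1 hab with h | h <;> rcases mul_pos_iff.1 hbc with h' | h'
    · exact Or.inl ⟨h.1, h.2, h'.2⟩
    · linarith
    · linarith
    · exact Or.inr ⟨h.1, h.2, h'.2⟩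
  have hs : a + b + c ≠ 0 := by
    rcases hsign with ⟨h₁, h₂, h₃⟩ | ⟨h₁, h₂, h₃⟩
    · positivity
    · linarith
  refine Set.Subset.antisymm (fun x hx => ?_) (fun x hx => ?_)
  · rcases eq_vertex_or_pos_of_mem_fixSet_skewThree ha hb hc hx with
      (h | h | h) | ⟨-, h0, h1, h2⟩
    · simp [h]
    · simp [h]
    · simp [h]
    · have hsum := (mem_fixSet_skewThree.1 hx).1.2.2.2
      refine Or.inr (Or.inr (Or.inr ?_))
      ext i
      fin_cases i
      · change x 0 = b / (a + b + c)
        rw [eq_div_iff hs]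
        linear_combination b * hsum - h1 + h2
      · change x 1 = c / (a + b + c)
        rw [eq_div_iff hs]
        linear_combination c * hsum + h0 - h2
      · change x 2 = a / (a + b + c)
        rw [eq_div_iff hs]
        linear_combination a * hsum - h0 + h1
  · rcases hx with h | h | h | rfl
    · exact vertices_subset_fixSet_skewThree a b c (Or.inl h)
    · exact vertices_subset_fixSet_skewThree a b c (Or.inr (Or.inl h))
    · exact vertices_subset_fixSet_skewThree a b c (Or.inr (Or.inr h))
    · rw [mem_fixSet_skewThree]
      simp only [Matrix.cons_val]
      refine ⟨⟨?_, ?_, ?_, by field_simp; ring⟩, by ring, by ring, by ring⟩ <;>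
        rcases hsign with ⟨h₁, h₂, h₃⟩ | ⟨h₁, h₂, h₃⟩ <;>
        first
          | positivity
          | exact div_nonneg_of_nonpos (by linarith) (by linarith)

theorem fixSet_skewThree_of_not_same_sign {a b c : ℝ} (ha : a ≠ 0) (hb : b ≠ 0) (hc : c ≠ 0)
    (h : ¬(0 < a * b ∧ 0 < b * c)) :
    FixSet (skewThree a b c) = {![1, 0, 0], ![0, 1, 0], ![0, 0, 1]} := by
  refine Set.Subset.antisymm (fun x hx => ?_) (vertices_subset_fixSet_skewThree a b c)
  rcases eq_vertex_or_pos_of_mem_fixSet_skewThree ha hb hc hx with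
    hv | ⟨⟨p0, p1, p2⟩, -, h1, h2⟩
  · exact hv
  · refine absurd ⟨?_, ?_⟩ h
    · refine pos_of_mul_pos_left (b := x 0) ?_ p0.le
      have : a * b * x 0 = b * b * x 2 := by linear_combination -b * h1
      rw [this]
      exact mul_pos (mul_self_pos.2 hb) p2
    · refine pos_of_mul_pos_left (b := x 0) ?_ p0.le
      have : b * c * x 0 = b * b * x 1 := by linear_combination b * h2
      rw [this]
      exact mul_pos (mul_self_pos.2 hb) p1

theorem ncard_fixSet_skewThree {a b c : ℝ} (ha : a ≠ 0) (hb : b ≠ 0) (hc : c ≠ 0) :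
    (FixSet (skewThree a b c)).ncard = if 0 < a * b ∧ 0 < b * c then 4 else 3 := by
  split_ifs with h
  · rw [fixSet_skewThree_of_same_sign h.1 h.2]
    have hs : a + b + c ≠ 0 := by
      intro hs
      have hmul : (a + b + c) * b = 0 := by rw [hs, zero_mul]
      nlinarith [mul_self_nonneg b, h.1, h.2]
    rw [Set.ncard_eq_toFinset_card']
    simp [Finset.card_insert_of_notMem, hs, ha, hb, hc, eq_comm]
  · rw [fixSet_skewThree_of_not_same_sign ha hb hc h, Set.ncard_eq_toFinset_card']
    simp [Finset.card_insert_of_notMem]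

theorem ncard_fixSet_skewThree_congr {a b c a' b' c' : ℝ} (ha : 0 < a * a') (hb : 0 < b * b')
    (hc : 0 < c * c') :
    (FixSet (skewThree a b c)).ncard = (FixSet (skewThree a' b' c')).ncard := by
  rw [ncard_fixSet_skewThree (left_ne_zero_of_mul ha.ne') (left_ne_zero_of_mul hb.ne')
      (left_ne_zero_of_mul hc.ne'),
    ncard_fixSet_skewThree (right_ne_zero_of_mul ha.ne') (right_ne_zero_of_mul hb.ne')
      (right_ne_zero_of_mul hc.ne')]
  have h₁ : 0 < a * b ↔ 0 < a' * b' := pos_iff_pos_of_mul_pos <| by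
    linarith [mul_pos ha hb]
  have h₂ : 0 < b * c ↔ 0 < b' * c' := pos_iff_pos_of_mul_pos <| by
    linarith [mul_pos hb hc]
  simp only [h₁, h₂]

theorem mul_convexCombination_pos {a a' t : ℝ} (h : 0 < a * a') (ht : t ∈ Set.Icc (0 : ℝ) 1) :
    0 < a * ((1 - t) * a + t * a') := by
  have ha : 0 < a * a := mul_self_pos.2 (left_ne_zero_of_mul h.ne')
  rcases ht.1.eq_or_lt with rfl | h0
  · simpa using ha
  · nlinarith [mul_pos h0 h, mul_nonneg (sub_nonneg.2 ht.2) ha.le]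

theorem abs_convexCombination_le_one {a a' t : ℝ} (h : |a| ≤ 1) (h' : |a'| ≤ 1)
    (ht : t ∈ Set.Icc (0 : ℝ) 1) : |(1 - t) * a + t * a'| ≤ 1 := by
  obtain ⟨h0, h1⟩ := ht
  rw [abs_le] at *
  constructor <;> nlinarith

theorem qsoHomotopic_skewThree {a b c a' b' c' : ℝ} (ha : |a| ≤ 1) (hb : |b| ≤ 1) (hc : |c| ≤ 1)
    (ha' : |a'| ≤ 1) (hb' : |b'| ≤ 1) (hc' : |c'| ≤ 1)
    (haa : 0 < a * a') (hbb : 0 < b * b') (hcc : 0 < c * c') :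
    QSOHomotopic (skewThree a b c) (skewThree a' b' c') := by
  refine ⟨fun t => skewThree ((1 - t) * a + t * a') ((1 - t) * b + t * b')
    ((1 - t) * c + t * c'), ?_, by simp, by simp, fun t ht => ?_, fun t ht => ?_,
    ncard_fixSet_skewThree_congr haa hbb hcc⟩
  · refine (continuous_matrix fun i j => ?_).continuousOn
    fin_cases i <;> fin_cases j <;> simp [skewThree] <;> fun_prop
  · have h₁ := abs_convexCombination_le_one ha ha' ht
    have h₂ := abs_convexCombination_le_one hb hb' ht
    have h₃ := abs_convexCombination_le_one hc hc' ht
    exact ⟨skewThree_isQSOMatrix h₁ h₂ h₃, skewThree_isTransversal h₁ h₂ h₃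
      (right_ne_zero_of_mul (mul_convexCombination_pos haa ht).ne')
      (right_ne_zero_of_mul (mul_convexCombination_pos hbb ht).ne')
      (right_ne_zero_of_mul (mul_convexCombination_pos hcc ht).ne')⟩
  · exact (ncard_fixSet_skewThree_congr (mul_convexCombination_pos haa ht)
      (mul_convexCombination_pos hbb ht) (mul_convexCombination_pos hcc ht)).symm

theorem QSOHomotopic.mul_apply_pos {n : Type*} [Fintype n] [DecidableEq n] {A₀ A₁ : Matrix n n ℝ}
    (h : QSOHomotopic A₀ A₁) {i j : n} (hij : i ≠ j) : 0 < A₀ i j * A₁ i j := by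
  obtain ⟨A, hcont, rfl, rfl, hA, -, -⟩ := h
  have hf : ContinuousOn (fun t => A t i j) (Set.Icc 0 1) :=
    ((continuous_id.matrix_elem i j).comp_continuousOn hcont)
  have hne : ∀ t ∈ Set.Icc (0 : ℝ) 1, A t i j ≠ 0 := fun t ht =>
    (hA t ht).2.apply_ne_zero (hA t ht).1 hij
  by_contra hneg
  have hmem : (0 : ℝ) ∈ Set.uIcc (A 0 i j) (A 1 i j) := by
    rw [Set.mem_uIcc]
    rcases mul_nonpos_iff.1 (not_lt.1 hneg) with h | h
    · exact Or.inr h.symm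
    · exact Or.inl h
  rw [← Set.uIcc_of_le zero_le_one] at hf hne
  obtain ⟨t, ht, h0⟩ := intermediate_value_uIcc hf hmem
  exact hne t ht h0

/-- The sign `±1` encoded by a Boolean. -/
def boolSign (s : Bool) : ℝ := if s then 1 else -1

theorem abs_boolSign (s : Bool) : |boolSign s| ≤ 1 := by
  cases s <;> simp [boolSign]

theorem boolSign_ne_zero (s : Bool) : boolSign s ≠ 0 := by
  cases s <;> simp [boolSign]

theorem eq_of_mul_boolSign_pos {s t : Bool} (h : 0 < boolSign s * boolSign t) : s = t := by
  cases s <;> cases t <;> simp [boolSign] at h ⊢ <;> linarith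

theorem exists_mul_boolSign_pos {a : ℝ} (ha : a ≠ 0) : ∃ s, 0 < a * boolSign s := by
  rcases ha.lt_or_gt with h | h
  · exact ⟨false, by simpa [boolSign] using h⟩
  · exact ⟨true, by simpa [boolSign] using h⟩

theorem eight_homotopy_classes_dim_three :
    ∃ B : Fin 8 → Matrix (Fin 3) (Fin 3) ℝ,
      (∀ i, IsQSOMatrix (B i) ∧ IsTransversal (B i)) ∧
      (∀ i j, i ≠ j → ¬ QSOHomotopic (B i) (B j)) ∧
      (∀ A : Matrix (Fin 3) (Fin 3) ℝ, IsQSOMatrix A → IsTransversal A →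
        ∃ i, QSOHomotopic A (B i)) := by
  let e : Fin 8 ≃ Bool × Bool × Bool := (Fintype.equivFinOfCardEq (by simp)).symm
  refine ⟨fun i => skewThree (boolSign (e i).1) (boolSign (e i).2.1) (boolSign (e i).2.2),
    fun i => ⟨?_, ?_⟩, fun i j hij h => hij (e.injective ?_), fun A hA hT => ?_⟩
  · exact skewThree_isQSOMatrix (abs_boolSign _) (abs_boolSign _) (abs_boolSign _)
  · exact skewThree_isTransversal (abs_boolSign _) (abs_boolSign _) (abs_boolSign _)
      (boolSign_ne_zero _) (boolSign_ne_zero _) (boolSign_ne_zero _)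
  · have h01 := h.mul_apply_pos (i := 0) (j := 1) (by decide)
    have h12 := h.mul_apply_pos (i := 1) (j := 2) (by decide)
    have h20 := h.mul_apply_pos (i := 2) (j := 0) (by decide)
    exact Prod.ext (eq_of_mul_boolSign_pos h01)
      (Prod.ext (eq_of_mul_boolSign_pos h12) (eq_of_mul_boolSign_pos h20))
  · obtain ⟨s, hs⟩ := exists_mul_boolSign_pos (hT.apply_ne_zero hA (i := 0) (j := 1) (by decide))
    obtain ⟨t, ht⟩ := exists_mul_boolSign_pos (hT.apply_ne_zero hA (i := 1) (j := 2) (by decide))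
    obtain ⟨u, hu⟩ := exists_mul_boolSign_pos (hT.apply_ne_zero hA (i := 2) (j := 0) (by decide))
    refine ⟨e.symm (s, t, u), ?_⟩
    rw [hA.eq_skewThree]
    simp only [Equiv.apply_symm_apply]
    exact qsoHomotopic_skewThree (hA.2 _ _) (hA.2 _ _) (hA.2 _ _) (abs_boolSign _)
      (abs_boolSign _) (abs_boolSign _) hs ht hu
end

section
/- Let A₀ and A be transversal real skew-symmetric m×m matrices with entries of absolute value ≤ 1, and let β ⊆ α ⊆ {1,…,m} with β nonempty. If the restrictions of V_A and V_{A₀} to the face Γ_α are homotopic (i.e. V_{A_α} and V_{(A₀)_α} are homotopic as Volterra operators on S^{|α|−1}), then the restrictions of V_A and V_{A₀} to the face Γ_β are homotopic (i.e. V_{A_β} and V_{(A₀)_β} are homotopic as Volterra operators on S^{|β|−1}). -/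
open Matrix

/-- The principal submatrix of `A` on the index set `α`, corresponding to the
restriction of the Volterra operator `V_A` to the face `Γ_α`. -/
def restrictM {m : ℕ} (A : Matrix (Fin m) (Fin m) ℝ) (α : Finset (Fin m)) :
    Matrix α α ℝ :=
  A.submatrix (fun i => (i : Fin m)) (fun i => (i : Fin m))

theorem IsQSOMatrix.submatrix {n k : Type*} [Fintype n] [Fintype k] {A : Matrix n n ℝ}
    (hA : IsQSOMatrix A) (f : k → n) : IsQSOMatrix (A.submatrix f f) := by
  refine ⟨?_, fun i j => hA.2 _ _⟩
  rw [transpose_submatrix, hA.1]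
  rfl

theorem IsTransversal.submatrix {n k : Type*} [Fintype n] [DecidableEq n] [Fintype k]
    [DecidableEq k] {A : Matrix n n ℝ} (hA : IsTransversal A) (f : k ↪ n) :
    IsTransversal (A.submatrix f f) := by
  intro s hs
  have h := hA (s.map f) (by rwa [Finset.card_map])
  let e : s → s.map f := fun i => ⟨f i, Finset.mem_map_of_mem f i.2⟩
  have he : Function.Bijective e := by
    refine ⟨fun i j hij => Subtype.ext (f.injective (congrArg Subtype.val hij)), fun j => ?_⟩
    obtain ⟨i, hi, hij⟩ := Finset.mem_map.1 j.2
    exact ⟨⟨i, hi⟩, Subtype.ext hij⟩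
  rwa [← det_submatrix_equiv_self (Equiv.ofBijective e he)] at h

/-- A transversal matrix of odd size has no nonzero vector vanishing at `i` whose image is
supported at `i`. -/
theorem IsTransversal.eq_zero_of_mulVec_eq_zero {n : Type*} [Fintype n] [DecidableEq n]
    {A : Matrix n n ℝ} (hA : IsTransversal A) (hn : Odd (Fintype.card n)) {x : n → ℝ} {i : n}
    (hx : ∀ k, k ≠ i → (A *ᵥ x) k = 0) (hi : x i = 0) : x = 0 := by
  have hs : Even (Finset.univ.erase i).card := by
    rw [Finset.card_erase_of_mem (Finset.mem_univ i), Finset.card_univ]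
    exact hn.tsub_odd odd_one
  have h := Matrix.eq_zero_of_mulVec_eq_zero (hA _ hs)
    (v := fun j : (Finset.univ.erase i : Finset n) => x j) (by
      funext k
      have hk := hx k (Finset.ne_of_mem_erase k.2)
      rw [mulVec, dotProduct, ← Finset.sum_erase (a := i) _ (by simp [hi])] at hk
      rw [← Finset.sum_coe_sort] at hk
      exact hk)
  funext j
  by_cases hj : j = i
  · rw [hj, hi]; rfl
  · exact congrFun h ⟨j, Finset.mem_erase.2 ⟨hj, Finset.mem_univ j⟩⟩

theorem IsTransversal.adjugate_self_ne_zero {n : Type*} [Fintype n] [DecidableEq n]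
    {A : Matrix n n ℝ} (hA : IsTransversal A) (hn : Odd (Fintype.card n)) (i : n) :
    A.adjugate i i ≠ 0 := by
  rw [adjugate_apply]
  intro h
  obtain ⟨v, hv, hv0⟩ := exists_mulVec_eq_zero_iff.2 h
  refine hv (hA.eq_zero_of_mulVec_eq_zero hn (i := i) (fun k hk => ?_) ?_)
  · simpa [mulVec, updateRow_ne hk] using congrFun hv0 k
  · simpa [mulVec] using congrFun hv0 i

theorem IsQSOMatrix.det_eq_zero {n : Type*} [Fintype n] [DecidableEq n]
    {A : Matrix n n ℝ} (hA : IsQSOMatrix A) (hn : Odd (Fintype.card n)) : A.det = 0 := by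
  have h := det_transpose A
  rw [hA.1, det_neg, hn.neg_one_pow] at h
  linarith

theorem IsQSOMatrix.mulVec_adjugate_col {n : Type*} [Fintype n] [DecidableEq n]
    {A : Matrix n n ℝ} (hA : IsQSOMatrix A) (hn : Odd (Fintype.card n)) (i : n) :
    A *ᵥ (fun j => A.adjugate j i) = 0 := by
  funext k
  have h := congrFun (congrFun (mul_adjugate A) k) i
  rw [hA.det_eq_zero hn, zero_smul] at h
  exact h

theorem IsTransversal.adjugate_ne_zero {n : Type*} [Fintype n] [DecidableEq n]
    {A : Matrix n n ℝ} (hA : IsTransversal A) (hA' : IsQSOMatrix A)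
    (hn : Odd (Fintype.card n)) (j i : n) : A.adjugate j i ≠ 0 := fun h =>
  hA.adjugate_self_ne_zero hn i <| congrFun (hA.eq_zero_of_mulVec_eq_zero hn
    (fun k _ => congrFun (hA'.mulVec_adjugate_col hn i) k) h) i

/-- A matrix has a strictly positive kernel vector. -/
def HasPosKernel {n : Type*} [Fintype n] (A : Matrix n n ℝ) : Prop :=
  ∃ x : n → ℝ, (∀ i, 0 < x i) ∧ A *ᵥ x = 0

theorem IsTransversal.hasPosKernel_iff {n : Type*} [Fintype n] [DecidableEq n]
    {A : Matrix n n ℝ} (hA : IsTransversal A) (hA' : IsQSOMatrix A)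
    (hn : Odd (Fintype.card n)) (i : n) :
    HasPosKernel A ↔ ∀ j, 0 < A.adjugate j i * A.adjugate i i := by
  have hw := hA.adjugate_self_ne_zero hn i
  have hker := hA'.mulVec_adjugate_col hn i
  constructor
  · rintro ⟨x, hx, hAx⟩ j
    have h0 : A.adjugate i i • x - x i • (fun j => A.adjugate j i) = 0 := by
      refine hA.eq_zero_of_mulVec_eq_zero hn (i := i) (fun k _ => ?_) ?_
      · rw [mulVec_sub, mulVec_smul, mulVec_smul, hAx, hker]
        simp
      · simp [mul_comm]
    have hj : A.adjugate i i * x j = x i * A.adjugate j i := by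
      simpa [sub_eq_zero] using congrFun h0 j
    have : 0 < x i * (A.adjugate j i * A.adjugate i i) := by
      rw [← mul_assoc, ← hj, mul_right_comm]
      exact mul_pos (mul_self_pos.2 hw) (hx j)
    exact pos_of_mul_pos_right this (hx i).le
  · intro h
    refine ⟨A.adjugate i i • fun j => A.adjugate j i, fun j => ?_, ?_⟩
    · simpa [mul_comm] using h j
    · rw [mulVec_smul, hker, smul_zero]

theorem IsPreconnected.pos_of_ne_zero {X : Type*} [TopologicalSpace X] {S : Set X}
    (hS : IsPreconnected S) {f : X → ℝ} (hf : ContinuousOn f S) (h0 : ∀ t ∈ S, f t ≠ 0)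
    {a b : X} (ha : a ∈ S) (hb : b ∈ S) (hfa : 0 < f a) : 0 < f b := by
  by_contra hfb
  obtain ⟨c, hc, hc0⟩ := hS.intermediate_value hb ha hf ⟨not_lt.1 hfb, hfa.le⟩
  exact h0 c hc hc0

/-- Along a connected family of transversal skew-symmetric matrices, existence of a positive
kernel vector persists. -/
theorem HasPosKernel.of_isPreconnected {X n : Type*} [TopologicalSpace X] [Fintype n]
    [DecidableEq n] {S : Set X} (hS : IsPreconnected S) {A : X → Matrix n n ℝ}
    (hc : ContinuousOn A S) (hA : ∀ t ∈ S, IsQSOMatrix (A t) ∧ IsTransversal (A t))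
    {a b : X} (ha : a ∈ S) (hb : b ∈ S) (h : HasPosKernel (A a)) : HasPosKernel (A b) := by
  rcases Nat.even_or_odd (Fintype.card n) with hn | hn
  · obtain ⟨x, hx, hx0⟩ := h
    have hdet : (A a).det ≠ 0 := by
      have h' := (hA a ha).2 Finset.univ hn
      rwa [← det_submatrix_equiv_self (Equiv.subtypeUnivEquiv Finset.mem_univ)]
    have := Matrix.eq_zero_of_mulVec_eq_zero hdet hx0
    refine ⟨x, hx, ?_⟩
    rw [this, mulVec_zero]
  · obtain ⟨i⟩ : Nonempty n := Fintype.card_pos_iff.1 hn.pos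
    rw [(hA a ha).2.hasPosKernel_iff (hA a ha).1 hn i] at h
    rw [(hA b hb).2.hasPosKernel_iff (hA b hb).1 hn i]
    intro j
    have hadj : ContinuousOn (fun t => (A t).adjugate) S :=
      (continuous_id.matrix_adjugate).comp_continuousOn hc
    have hent : ∀ k l, ContinuousOn (fun t => (A t).adjugate k l) S := fun k l =>
      (continuous_id.matrix_elem k l).comp_continuousOn hadj
    exact hS.pos_of_ne_zero ((hent j i).mul (hent i i))
      (fun t ht => mul_ne_zero ((hA t ht).2.adjugate_ne_zero (hA t ht).1 hn j i)
        ((hA t ht).2.adjugate_ne_zero (hA t ht).1 hn i i)) ha hb (h j)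

/-- The support of a vector as a finite set. -/
noncomputable def vecSupport {n : Type*} [Fintype n] (x : n → ℝ) : Finset n :=
  Finset.univ.filter fun i => x i ≠ 0

theorem mem_vecSupport {n : Type*} [Fintype n] {x : n → ℝ} {i : n} :
    i ∈ vecSupport x ↔ x i ≠ 0 := by
  simp [vecSupport]

theorem sum_coe_of_vecSupport_subset {n : Type*} [Fintype n] {x : n → ℝ}
    {s : Finset n} (hs : vecSupport x ⊆ s) (c : n → ℝ) :
    ∑ i : s, c i * x i = ∑ i, c i * x i := by
  rw [Finset.sum_coe_sort s (fun i => c i * x i)]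
  refine Finset.sum_subset (Finset.subset_univ s) fun i _ hi => ?_
  rw [not_not.1 fun h => hi (hs (mem_vecSupport.2 h)), mul_zero]

theorem volterra_eq_self_iff {n : Type*} [Fintype n] {A : Matrix n n ℝ} {x : n → ℝ} :
    volterra A x = x ↔ (A.submatrix (fun i : vecSupport x => (i : n))
      (fun i : vecSupport x => (i : n))) *ᵥ (fun i : vecSupport x => x i) = 0 := by
  have key : ∀ k : n, ∑ i : vecSupport x, A k i * x i = ∑ i, A k i * x i := fun k =>
    sum_coe_of_vecSupport_subset subset_rfl (A k)
  constructor
  · intro h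
    funext k
    have hk := congrFun h k
    have hk0 := mem_vecSupport.1 k.2
    have : x k * ∑ i, A k i * x i = 0 := by
      simp only [volterra] at hk
      linarith
    exact (key k).trans ((mul_eq_zero.1 this).resolve_left hk0)
  · intro h
    funext k
    by_cases hk : x k = 0
    · simp [volterra, hk]
    · have hk' : ∑ i, A k i * x i = 0 :=
        (key k).symm.trans (congrFun h ⟨k, mem_vecSupport.2 hk⟩)
      simp [volterra, hk']

/-- A set is the support of a fixed point iff it is nonempty and the corresponding principal
submatrix has a positive kernel vector. -/
theorem mem_vecSupport_image_fixSet_iff {n : Type*} [Fintype n] {A : Matrix n n ℝ}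
    {s : Finset n} : s ∈ vecSupport '' FixSet A ↔ s.Nonempty ∧
      HasPosKernel (A.submatrix (fun i : s => (i : n)) (fun i : s => (i : n))) := by
  classical
  constructor
  · rintro ⟨x, ⟨⟨hx0, hx1⟩, hfix⟩, rfl⟩
    refine ⟨?_, fun i => x i, fun i => ?_, volterra_eq_self_iff.1 hfix⟩
    · obtain ⟨i, -, hi⟩ := Finset.exists_ne_zero_of_sum_ne_zero (hx1.trans_ne one_ne_zero)
      exact ⟨i, mem_vecSupport.2 hi⟩
    · exact lt_of_le_of_ne (hx0 i) (mem_vecSupport.1 i.2).symm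
  · rintro ⟨hs, y, hy, hAy⟩
    have := hs.to_subtype
    have hc : 0 < ∑ i, y i := Finset.sum_pos (fun i _ => hy i) Finset.univ_nonempty
    set c := ∑ i, y i
    set x : n → ℝ := fun i => if h : i ∈ s then c⁻¹ * y ⟨i, h⟩ else 0 with hx
    have hxs : ∀ i : s, x i = c⁻¹ * y i := fun i => by simp [hx]
    have hsupp : vecSupport x = s := by
      ext i
      rw [mem_vecSupport]
      by_cases hi : i ∈ s
      · simp [hx, hi, hc.ne', (hy ⟨i, hi⟩).ne']
      · simp [hx, hi]
    refine ⟨x, ⟨⟨fun i => ?_, ?_⟩, ?_⟩, hsupp⟩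
    · by_cases hi : i ∈ s
      · simpa [hx, hi] using mul_nonneg (inv_nonneg.2 hc.le) (hy ⟨i, hi⟩).le
      · simp [hx, hi]
    · have h := sum_coe_of_vecSupport_subset hsupp.le (fun _ => 1)
      simp only [one_mul] at h
      rw [← h, Finset.sum_congr rfl fun i _ => hxs i, ← Finset.mul_sum]
      exact inv_mul_cancel₀ hc.ne'
    · rw [volterra_eq_self_iff, hsupp, show (fun i : s => x i) = c⁻¹ • y from funext hxs,
        mulVec_smul, hAy, smul_zero]

/-- Fixed points of a transversal Volterra operator are determined by their support. -/
theorem IsTransversal.injOn_vecSupport {n : Type*} [Fintype n] [DecidableEq n]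
    {A : Matrix n n ℝ} (hA : IsTransversal A) : Set.InjOn vecSupport (FixSet A) := by
  rintro x ⟨hx, hfx⟩ y ⟨hy, hfy⟩ hxy
  rw [volterra_eq_self_iff] at hfx hfy
  rw [← hxy] at hfy
  set s := vecSupport x with hs
  have hx1 : ∑ i : s, x i = 1 := by
    simpa using (sum_coe_of_vecSupport_subset hs.ge (fun _ => 1)).trans (by simpa using hx.2)
  have hy1 : ∑ i : s, y i = 1 := by
    simpa using (sum_coe_of_vecSupport_subset hxy.ge (fun _ => 1)).trans (by simpa using hy.2)
  have hres : ∀ i : s, x i = y i := by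
    rcases Nat.even_or_odd s.card with hn | hn
    · have h := Matrix.eq_zero_of_mulVec_eq_zero (hA s hn) hfx
      simp [fun i => show x (i : s) = 0 from congrFun h i] at hx1
    · have hn' : Odd (Fintype.card s) := by rwa [Fintype.card_coe]
      obtain ⟨i⟩ : Nonempty s := Fintype.card_pos_iff.1 hn'.pos
      have h0 : (y i • (fun j : s => x j) - x i • fun j : s => y j) = 0 := by
        refine (hA.submatrix (Function.Embedding.subtype (· ∈ s))).eq_zero_of_mulVec_eq_zero hn'
          (i := i) (fun k _ => ?_) (by simp [mul_comm])
        have hz := congrArg₂ (fun u v => y i • u - x i • v) hfx hfy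
        simp only [← mulVec_smul, ← mulVec_sub, smul_zero, sub_zero] at hz
        exact congrFun hz k
      have h1 : ∀ j : s, y i * x j = x i * y j := fun j => by
        simpa [sub_eq_zero] using congrFun h0 j
      have hi : y i = x i := by
        have := Finset.sum_congr rfl fun j (_ : j ∈ Finset.univ) => h1 j
        rwa [← Finset.mul_sum, ← Finset.mul_sum, hx1, hy1, mul_one, mul_one] at this
      intro j
      have hj := h1 j
      rw [hi] at hj
      exact mul_left_cancel₀ (mem_vecSupport.1 i.2) hj
  funext i
  by_cases hi : i ∈ s
  · exact hres ⟨i, hi⟩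
  · have h1 : x i = 0 := not_not.1 fun h => hi (mem_vecSupport.2 h)
    have h2 : y i = 0 := not_not.1 fun h => hi (hxy ▸ mem_vecSupport.2 h)
    rw [h1, h2]

/-- The number of fixed points is constant along a connected family of transversal Volterra
operators. -/
theorem ncard_fixSet_eq_of_isPreconnected {X n : Type*} [TopologicalSpace X] [Fintype n]
    [DecidableEq n] {S : Set X} (hS : IsPreconnected S) {A : X → Matrix n n ℝ}
    (hc : ContinuousOn A S) (hA : ∀ t ∈ S, IsQSOMatrix (A t) ∧ IsTransversal (A t))
    {a b : X} (ha : a ∈ S) (hb : b ∈ S) : (FixSet (A a)).ncard = (FixSet (A b)).ncard := by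
  have hsub : ∀ s : Finset n, ∀ {a b : X}, a ∈ S → b ∈ S →
      HasPosKernel ((A a).submatrix (fun i : s => (i : n)) (fun i : s => (i : n))) →
      HasPosKernel ((A b).submatrix (fun i : s => (i : n)) (fun i : s => (i : n))) :=
    fun s _ _ ha hb => HasPosKernel.of_isPreconnected hS
      ((continuous_id.matrix_submatrix _ _).comp_continuousOn hc)
      (fun t ht => ⟨(hA t ht).1.submatrix _,
        (hA t ht).2.submatrix (Function.Embedding.subtype (· ∈ s))⟩) ha hb
  rw [← (hA a ha).2.injOn_vecSupport.ncard_image,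
    ← (hA b hb).2.injOn_vecSupport.ncard_image]
  congr 1
  ext s
  rw [mem_vecSupport_image_fixSet_iff, mem_vecSupport_image_fixSet_iff]
  exact and_congr_right fun _ => ⟨hsub s ha hb, hsub s hb ha⟩

theorem homotopic_on_face_mono {m : ℕ} (A₀ A : Matrix (Fin m) (Fin m) ℝ)
    (h₀ : IsQSOMatrix A₀) (hA : IsQSOMatrix A)
    (t₀ : IsTransversal A₀) (tA : IsTransversal A)
    (α β : Finset (Fin m)) (hβα : β ⊆ α) (hβ : β.Nonempty)
    (h : QSOHomotopic (restrictM A α) (restrictM A₀ α)) :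
    QSOHomotopic (restrictM A β) (restrictM A₀ β) := by
  obtain ⟨B, hc, hB0, hB1, hB, -, -⟩ := h
  let e : β ↪ α := ⟨fun i => ⟨i, hβα i.2⟩, fun i j hij => Subtype.ext (congrArg (·.1) hij)⟩
  have hC0 : (B 0).submatrix e e = restrictM A β := by rw [hB0]; rfl
  have hC1 : (B 1).submatrix e e = restrictM A₀ β := by rw [hB1]; rfl
  have hCc : ContinuousOn (fun t => (B t).submatrix e e) (Set.Icc 0 1) :=
    (continuous_id.matrix_submatrix e e).comp_continuousOn hc
  have hC : ∀ t ∈ Set.Icc (0 : ℝ) 1,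
      IsQSOMatrix ((B t).submatrix e e) ∧ IsTransversal ((B t).submatrix e e) := fun t ht =>
    ⟨(hB t ht).1.submatrix e, (hB t ht).2.submatrix e⟩
  have hcard : ∀ t ∈ Set.Icc (0 : ℝ) 1,
      (FixSet ((B t).submatrix e e)).ncard = (FixSet (restrictM A β)).ncard := fun t ht => by
    rw [← hC0]
    exact ncard_fixSet_eq_of_isPreconnected isPreconnected_Icc hCc hC ht
      (Set.left_mem_Icc.2 zero_le_one)
  refine ⟨fun t => (B t).submatrix e e, hCc, hC0, hC1, hC, hcard, ?_⟩
  rw [← hC1]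
  exact (hcard 1 (Set.right_mem_Icc.2 zero_le_one)).symm
end
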